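/- Every projective aOka-1 manifold is rationally connected. -/

import Mathlib

open scoped Manifold Topology LinearAlgebra.Projectivization
open Set Asymptotics

noncomputable section

/-- The quotient topology on projective space. -/
instance {V : Type*} [AddCommGroup V] [Module ℂ V] [TopologicalSpace V] :
    TopologicalSpace (ℙ ℂ V) :=
  inferInstanceAs (TopologicalSpace (Quotient (projectivizationSetoid ℂ V)))

/-- Complex projective `N`-space. -/
abbrev ProjSp (N : ℕ) := ℙ ℂ (Fin (N + 1) → ℂ)

/-- The ratio of the `j`-th and `i`-th homogeneous coordinates of a point of `ℙ^N`
(independent of the chosen representative). -/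
def projRatio {N : ℕ} (i j : Fin (N + 1)) (q : ProjSp N) : ℂ := q.rep j / q.rep i

/-- The `ℓ`-th affine chart of `ℙ^N`. -/
def affChart {N : ℕ} (ℓ : Fin (N + 1)) (q : ProjSp N) : Fin N → ℂ :=
  fun j => q.rep (ℓ.succAbove j) / q.rep ℓ

/-- The common zero set of a family of polynomials in affine space `ℂ^ι`. -/
def AffZeroLocus {ι : Type*} (s : Set (MvPolynomial ι ℂ)) : Set (ι → ℂ) :=
  {x | ∀ P ∈ s, MvPolynomial.eval x P = 0}

/-- An affine algebraic variety: the common zero set of finitely many polynomials. -/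
def IsAffineVariety {ι : Type*} (V : Set (ι → ℂ)) : Prop :=
  ∃ s : Finset (MvPolynomial ι ℂ), V = AffZeroLocus (↑s : Set (MvPolynomial ι ℂ))

/-- A function on a subvariety `S` of affine space is holomorphic on `U ⊆ S` if it locally
extends to a holomorphic function of the ambient space. -/
def HolomorphicOnSubvariety {ι : Type*} [Fintype ι] (S : Set (ι → ℂ)) (h : ↥S → ℂ)
    (U : Set ↥S) : Prop :=
  ∀ p ∈ U, ∃ W : Set (ι → ℂ), IsOpen W ∧ (↑p : ι → ℂ) ∈ W ∧
    (Subtype.val ⁻¹' W : Set ↥S) ⊆ U ∧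
    ∃ Hf : (ι → ℂ) → ℂ, DifferentiableOn ℂ Hf W ∧ ∀ q : ↥S, (↑q : ι → ℂ) ∈ W → h q = Hf ↑q

/-- A map from a subvariety `S` of affine space to `ℙ^N` is holomorphic on `U ⊆ S` if it
locally lifts to a nonvanishing holomorphic map into `ℂ^{N+1} ∖ {0}`. -/
def HoloToProjOn {ι : Type*} [Fintype ι] {N : ℕ} (S : Set (ι → ℂ)) (f : ↥S → ProjSp N)
    (U : Set ↥S) : Prop :=
  ∀ p ∈ U, ∃ W : Set (ι → ℂ), IsOpen W ∧ (↑p : ι → ℂ) ∈ W ∧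
    (Subtype.val ⁻¹' W : Set ↥S) ⊆ U ∧
    ∃ G : (ι → ℂ) → (Fin (N + 1) → ℂ), DifferentiableOn ℂ G W ∧
      ∀ q : ↥S, (↑q : ι → ℂ) ∈ W →
        ∃ hG : G ↑q ≠ 0, f q = Projectivization.mk ℂ (G ↑q) hG

/-- An algebraic morphism (regular map) from a subvariety `S` of affine space to `ℙ^N`:
Zariski-locally it is given by a tuple of polynomials without common zeros. -/
def MorphismToProjOf {ι : Type*} [Fintype ι] {N : ℕ} (S : Set (ι → ℂ))
    (f : ↥S → ProjSp N) : Prop :=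
  ∀ p : ↥S, ∃ g : Fin (N + 1) → MvPolynomial ι ℂ,
    (fun j => MvPolynomial.eval (↑p : ι → ℂ) (g j)) ≠ 0 ∧
    ∀ q : ↥S, ∀ hq : (fun j => MvPolynomial.eval (↑q : ι → ℂ) (g j)) ≠ 0,
      f q = Projectivization.mk ℂ _ hq

/-- An affine algebraic Riemann surface: a smooth connected closed affine algebraic curve
(equivalently, the complement of finitely many points in a compact Riemann surface). -/
def IsAffineAlgebraicRiemannSurface {ι : Type*} [Fintype ι] (R : Set (ι → ℂ)) : Prop :=
  IsAffineVariety R ∧ IsConnected R ∧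
  ∀ p ∈ R, ∃ (W : Set (ι → ℂ)) (V : Set ℂ) (φ : ℂ → ι → ℂ),
    IsOpen W ∧ p ∈ W ∧ IsOpen V ∧ DifferentiableOn ℂ φ V ∧ InjOn φ V ∧
    (∀ z ∈ V, fderiv ℂ φ z ≠ 0) ∧ R ∩ W = φ '' V

/-- A Runge (that is, `𝒪(S)`-convex) compact set in an affine variety `S`. -/
def IsRungeCompactIn {ι : Type*} [Fintype ι] (S : Set (ι → ℂ)) (K : Set ↥S) : Prop :=
  IsCompact K ∧ ∀ x : ↥S, x ∉ K →
    ∃ h : ↥S → ℂ, HolomorphicOnSubvariety S h univ ∧ (⨆ y ∈ K, ‖h y‖) < ‖h x‖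

/-- Two maps from a curve `R` to `ℙ^N` agree to order `k` at the point `a`:
in every local holomorphic parametrisation of `R` at `a` and every affine chart of `ℙ^N` at
the common value, the difference of the two maps vanishes to order `k`. -/
def AgreeToOrderOnCurveAt {ι : Type*} [Fintype ι] {N : ℕ} (R : Set (ι → ℂ))
    (F f : ↥R → ProjSp N) (k : ℕ) (a : ↥R) : Prop :=
  F a = f a ∧
  ∀ (V : Set ℂ) (φ : ℂ → ι → ℂ) (z₀ : ℂ), IsOpen V → z₀ ∈ V →
    DifferentiableOn ℂ φ V → ∀ hφR : ∀ z ∈ V, φ z ∈ R, φ z₀ = (↑a : ι → ℂ) →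
    fderiv ℂ φ z₀ ≠ 0 →
    ∀ i j : Fin (N + 1), (f a).rep i ≠ 0 →
      (fun z => @dite _ (z ∈ V) (Classical.propDecidable _)
          (fun hz => projRatio i j (F ⟨φ z, hφR z hz⟩) - projRatio i j (f ⟨φ z, hφR z hz⟩))
          (fun _ => 0)) =o[𝓝 z₀] fun z => ‖z - z₀‖ ^ k

/-- A complex algebraic manifold `X ⊆ ℙ^N` is algebraically Oka-1 (aOka-1) if for every
affine algebraic Riemann surface `R`, every Runge compact `K ⊆ R`, every finite `A ⊆ K`,
every continuous map `f : R → X` holomorphic on a neighbourhood of `K`, every `ε > 0` and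
every `k ∈ ℕ`, there is an algebraic morphism `F : R → X` homotopic to `f`, with
`dist (F p) (f p) < ε` for `p ∈ K` (for any metric inducing the topology of `X`), which
agrees with `f` to order `k` at every point of `A`. -/
def IsAOka1 {N : ℕ} (X : Set (ProjSp N)) : Prop :=
  ∀ (M : ℕ) (R : Set (Fin M → ℂ)), IsAffineAlgebraicRiemannSurface R →
  ∀ K : Set ↥R, IsRungeCompactIn R K →
  ∀ A : Set ↥R, A.Finite → A ⊆ K →
  ∀ (f : C(↥R, ↥X)) (U : Set ↥R), IsOpen U → K ⊆ U →
    HoloToProjOn R (fun p => (↑(f p) : ProjSp N)) U →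
  ∀ ε : ℝ, 0 < ε → ∀ k : ℕ,
  ∀ dX : MetricSpace ↥X,
    dX.toPseudoMetricSpace.toUniformSpace.toTopologicalSpace
      = (inferInstance : TopologicalSpace ↥X) →
  ∃ F : C(↥R, ↥X), MorphismToProjOf R (fun p => (↑(F p) : ProjSp N)) ∧ F.Homotopic f ∧
    (∀ p ∈ K, @dist _ dX.toPseudoMetricSpace.toDist (F p) (f p) < ε) ∧
    ∀ a ∈ A, AgreeToOrderOnCurveAt R (fun p => (↑(F p) : ProjSp N))
      (fun p => (↑(f p) : ProjSp N)) k a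

/-- The zero set in `ℙ^N` of a family of (homogeneous) polynomials. -/
def ProjZeroLocus {N : ℕ} (s : Set (MvPolynomial (Fin (N + 1)) ℂ)) : Set (ProjSp N) :=
  {q | ∀ P ∈ s, MvPolynomial.eval q.rep P = 0}

/-- A projective algebraic variety in `ℙ^N`. -/
def IsProjectiveVariety {N : ℕ} (X : Set (ProjSp N)) : Prop :=
  ∃ s : Finset (MvPolynomial (Fin (N + 1)) ℂ),
    (∀ P ∈ s, ∃ d, P.IsHomogeneous d) ∧ X = ProjZeroLocus (↑s : Set _)

/-- The affine cone (without the origin) over a subset of `ℙ^N`. -/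
def projCone {N : ℕ} (X : Set (ProjSp N)) : Set (Fin (N + 1) → ℂ) :=
  {v | ∃ hv : v ≠ 0, Projectivization.mk ℂ v hv ∈ X}

/-- `X ⊆ ℙ^N` is a complex submanifold of dimension `n`: its affine cone is locally cut out
by holomorphic submersions with `N - n` components. -/
def IsSmoothOfDim {N : ℕ} (X : Set (ProjSp N)) (n : ℕ) : Prop :=
  ∀ v ∈ projCone X, ∃ (W : Set (Fin (N + 1) → ℂ)) (g : (Fin (N + 1) → ℂ) → Fin (N - n) → ℂ),
    IsOpen W ∧ v ∈ W ∧ DifferentiableOn ℂ g W ∧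
    (∀ w ∈ W, Function.Surjective (fderiv ℂ g w)) ∧
    projCone X ∩ W = {w ∈ W | g w = 0}

/-- A complex algebraic manifold: a smooth quasi-projective subvariety of `ℙ^N`. -/
def IsAlgebraicManifold {N : ℕ} (X : Set (ProjSp N)) (n : ℕ) : Prop :=
  (∃ Y Z : Set (ProjSp N), IsProjectiveVariety Y ∧ IsProjectiveVariety Z ∧ X = Y \ Z) ∧
  IsSmoothOfDim X n

/-- A projective manifold: a smooth projective subvariety of `ℙ^N`. -/
def IsProjectiveManifold {N : ℕ} (X : Set (ProjSp N)) (n : ℕ) : Prop :=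
  IsProjectiveVariety X ∧ IsSmoothOfDim X n



/-- An algebraic morphism between (quasi-)projective varieties `X ⊆ ℙ^N` and `Y ⊆ ℙ^{N'}`:
at every point it is given by a tuple of homogeneous polynomials of the same degree without
common zeros. -/
def MorphismOfQP {N N' : ℕ} (X : Set (ProjSp N)) (Y : Set (ProjSp N')) (F : ↥X → ↥Y) : Prop :=
  ∀ p : ↥X, ∃ (g : Fin (N' + 1) → MvPolynomial (Fin (N + 1)) ℂ) (d : ℕ),
    (∀ j, (g j).IsHomogeneous d) ∧
    (fun j => MvPolynomial.eval (↑p : ProjSp N).rep (g j)) ≠ 0 ∧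
    ∀ q : ↥X, ∀ hq : (fun j => MvPolynomial.eval (↑q : ProjSp N).rep (g j)) ≠ 0,
      (↑(F q) : ProjSp N') = Projectivization.mk ℂ _ hq

/-- An algebraic morphism defined on a subset `U` of `ℙ^N`. -/
def MorphismOnSubset {N N' : ℕ} (U : Set (ProjSp N)) (F : ProjSp N → ProjSp N') : Prop :=
  ∀ q ∈ U, ∃ (g : Fin (N' + 1) → MvPolynomial (Fin (N + 1)) ℂ) (d : ℕ),
    (∀ j, (g j).IsHomogeneous d) ∧
    (fun j => MvPolynomial.eval (Projectivization.rep q) (g j)) ≠ 0 ∧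
    ∀ q' ∈ U, ∀ hq : (fun j => MvPolynomial.eval (Projectivization.rep q') (g j)) ≠ 0,
      F q' = Projectivization.mk ℂ _ hq

/-- Birational equivalence of (quasi-)projective varieties: mutually inverse rational maps,
defined and regular on dense Zariski-open subsets. -/
def BirationallyEquivalent {N N' : ℕ} (X : Set (ProjSp N)) (Y : Set (ProjSp N')) : Prop :=
  ∃ (C : Set (ProjSp N)) (C' : Set (ProjSp N'))
    (F : ProjSp N → ProjSp N') (G : ProjSp N' → ProjSp N),
    IsProjectiveVariety C ∧ IsProjectiveVariety C' ∧
    MorphismOnSubset (X \ C) F ∧ MorphismOnSubset (Y \ C') G ∧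
    MapsTo F (X \ C) Y ∧ MapsTo G (Y \ C') X ∧
    X ⊆ closure ((X \ C) ∩ F ⁻¹' (Y \ C')) ∧
    Y ⊆ closure ((Y \ C') ∩ G ⁻¹' (X \ C)) ∧
    (∀ q ∈ (X \ C) ∩ F ⁻¹' (Y \ C'), G (F q) = q) ∧
    (∀ q ∈ (Y \ C') ∩ G ⁻¹' (X \ C), F (G q) = q)

/-- A Zariski-open subset of `X ⊆ ℙ^N`. -/
def ZariskiOpenIn {N : ℕ} (X : Set (ProjSp N)) (U : Set ↥X) : Prop :=
  ∃ C : Set (ProjSp N), IsProjectiveVariety C ∧ U = {p : ↥X | (↑p : ProjSp N) ∉ C}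

/-- A regular (algebraic) function on a subset `U` of a variety `X ⊆ ℙ^N`: locally a ratio
of homogeneous polynomials of the same degree. -/
def RegularFunOn {N : ℕ} (X : Set (ProjSp N)) (c : ↥X → ℂ) (U : Set ↥X) : Prop :=
  ∀ p ∈ U, ∃ (P Q : MvPolynomial (Fin (N + 1)) ℂ) (d : ℕ),
    P.IsHomogeneous d ∧ Q.IsHomogeneous d ∧
    MvPolynomial.eval (↑p : ProjSp N).rep Q ≠ 0 ∧
    ∀ q ∈ U, MvPolynomial.eval (↑q : ProjSp N).rep Q ≠ 0 →
      c q = MvPolynomial.eval (↑q : ProjSp N).rep P / MvPolynomial.eval (↑q : ProjSp N).rep Q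

/-- An algebraic manifold `X ⊆ ℙ^N` of dimension `n` is algebraically elliptic: it carries a
dominating algebraic spray `s : E → X` defined on the total space of an algebraic vector
bundle `E → X` (with algebraic zero section `z`, Zariski-locally trivial with fibrewise
linear transition maps), i.e. `s ∘ z = id` and for every `x ∈ X` the differential at `0_x`
of the restriction of `s` to the fibre `E_x` is surjective onto `T_x X` (equivalently, has
rank `n = dim X`). -/
def IsAlgebraicallyElliptic {N : ℕ} (n : ℕ) (X : Set (ProjSp N)) : Prop :=
  ∃ (K kE : ℕ) (Etot : Set (ProjSp K)), IsAlgebraicManifold Etot kE ∧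
  ∃ (π : ↥Etot → ↥X) (z : ↥X → ↥Etot) (s : ↥Etot → ↥X),
    MorphismOfQP Etot X π ∧ MorphismOfQP X Etot z ∧ MorphismOfQP Etot X s ∧
    (∀ x, π (z x) = x) ∧ (∀ x, s (z x) = x) ∧
    ∃ (ι : Type) (U : ι → Set ↥X) (r : ι → ℕ)
      (c : ∀ i, ↥Etot → (Fin (r i) → ℂ)) (ψ : ∀ i, ↥X → (Fin (r i) → ℂ) → ↥Etot),
      (∀ i, ZariskiOpenIn X (U i)) ∧ (⋃ i, U i) = univ ∧
      (∀ i (j : Fin (r i)), RegularFunOn Etot (fun e => c i e j) (π ⁻¹' U i)) ∧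
      (∀ i, ∀ x ∈ U i, ∀ v, π (ψ i x v) = x ∧ c i (ψ i x v) = v) ∧
      (∀ i, ∀ e : ↥Etot, π e ∈ U i → ψ i (π e) (c i e) = e) ∧
      (∀ i, ∀ x ∈ U i, c i (z x) = 0) ∧
      (∀ i, ∃ (g : Fin (K + 1) → MvPolynomial (Fin (N + 1) ⊕ Fin (r i)) ℂ) (d : ℕ),
        (∀ a, (g a).IsWeightedHomogeneous (Sum.elim (fun _ => (1 : ℕ)) fun _ => 0) d) ∧
        ∀ x ∈ U i, ∀ v,
          ∃ hg : (fun a =>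
              MvPolynomial.eval (Sum.elim (↑x : ProjSp N).rep v) (g a)) ≠ 0,
            (↑(ψ i x v) : ProjSp K) = Projectivization.mk ℂ _ hg) ∧
      (∀ i i', ∀ x : ↥X, x ∈ U i → x ∈ U i' →
        ∃ T : (Fin (r i) → ℂ) →ₗ[ℂ] (Fin (r i') → ℂ),
          ∀ e : ↥Etot, π e = x → c i' e = T (c i e)) ∧
      (∀ x : ↥X, ∃ i, x ∈ U i ∧ ∃ ℓ : Fin (N + 1), (↑x : ProjSp N).rep ℓ ≠ 0 ∧
        Module.finrank ℂ
          (LinearMap.range ((fderiv ℂ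
            (fun v : Fin (r i) → ℂ => affChart ℓ (↑(s (ψ i x v)) : ProjSp N)) 0)
              : (Fin (r i) → ℂ) →ₗ[ℂ] (Fin N → ℂ))) = n)

/-- A morphism `ℙ¹ → ℙ^N` (a rational curve): given by a tuple of homogeneous polynomials in
two variables of the same degree without common zeros. -/
def MorphismFromP1 {N : ℕ} (F : ProjSp 1 → ProjSp N) : Prop :=
  ∃ (g : Fin (N + 1) → MvPolynomial (Fin 2) ℂ) (d : ℕ),
    (∀ j, (g j).IsHomogeneous d) ∧
    ∀ q : ProjSp 1, ∃ h : (fun j => MvPolynomial.eval q.rep (g j)) ≠ 0,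
      F q = Projectivization.mk ℂ _ h

/-- A (connected) subvariety `X ⊆ ℙ^N` is rationally connected: any two of its points lie on
the image of a morphism `ℙ¹ → X`. -/
def IsRationallyConnected {N : ℕ} (X : Set (ProjSp N)) : Prop :=
  ∀ p ∈ X, ∀ q ∈ X, ∃ F : ProjSp 1 → ProjSp N, MorphismFromP1 F ∧
    range F ⊆ X ∧ p ∈ range F ∧ q ∈ range F



/-! ### Holomorphic submersions -/

/-- A map which is complex differentiable on an open subset of a finite-dimensional space is
strictly differentiable there. -/
theorem hasStrictFDerivAt_of_differentiableOn_complex {E F : Type*} [NormedAddCommGroup E]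
    [NormedSpace ℂ E] [FiniteDimensional ℂ E] [NormedAddCommGroup F] [NormedSpace ℂ F]
    {g : E → F} {W : Set E} (hg : DifferentiableOn ℂ g W) (hW : IsOpen W) {x : E}
    (hx : x ∈ W) : HasStrictFDerivAt g (fderiv ℂ g x) x := by
  have hproper : ProperSpace E := FiniteDimensional.proper ℂ E
  let _ : NormedSpace ℝ E := NormedSpace.restrictScalars ℝ ℂ E
  refine hasStrictFDerivAt_of_hasFDerivAt_of_continuousAt (f' := fderiv ℂ g) ?_ ?_
  · filter_upwards [hW.mem_nhds hx] with y hy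
    exact (hg.differentiableAt (hW.mem_nhds hy)).hasFDerivAt
  · obtain ⟨ρ, hρ, hball⟩ := Metric.nhds_basis_closedBall.mem_iff.1 (hW.mem_nhds hx)
    have huc : UniformContinuousOn g (Metric.closedBall x ρ) :=
      (isCompact_closedBall x ρ).uniformContinuousOn_of_continuous (hg.continuousOn.mono hball)
    rw [Metric.continuousAt_iff]
    intro ε hε
    set r := ρ / 2 with hr
    have hr0 : 0 < r := by positivity
    obtain ⟨δ, hδ, hgδ⟩ := Metric.uniformContinuousOn_iff.1 huc (ε / 2 * r) (by positivity)
    refine ⟨min δ r, by positivity, fun {w} hw => ?_⟩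
    have hwδ : dist w x < δ := hw.trans_le (min_le_left _ _)
    have hwr : dist w x < r := hw.trans_le (min_le_right _ _)
    rw [dist_eq_norm]
    refine lt_of_le_of_lt ?_ (half_lt_self hε)
    refine ContinuousLinearMap.opNorm_le_of_unit_norm (by positivity) fun u hu => ?_
    have hmem : ∀ y, dist y x < r → ∀ t : ℂ, ‖t‖ ≤ r → y + t • u ∈ Metric.closedBall x ρ := by
      intro y hy t ht
      rw [Metric.mem_closedBall]
      calc dist (y + t • u) x ≤ dist (y + t • u) y + dist y x := dist_triangle _ _ _
        _ ≤ r + r := by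
          gcongr
          rw [dist_eq_norm, add_sub_cancel_left, norm_smul, hu, mul_one]
          exact ht
        _ = ρ := by rw [hr]; ring
    have hline : ∀ y, dist y x < r → ∀ t : ℂ, ‖t‖ ≤ r →
        HasDerivAt (fun t : ℂ => g (y + t • u)) (fderiv ℂ g (y + t • u) u) t := by
      intro y hy t ht
      have h1 : HasDerivAt (fun t : ℂ => y + t • u) u t := by
        simpa using ((hasDerivAt_id t).smul_const u).const_add y
      exact (hg.differentiableAt
        (hW.mem_nhds (hball (hmem y hy t ht)))).hasFDerivAt.comp_hasDerivAt t h1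
    have hxr : dist x x < r := by simpa using hr0
    have hdiff : ∀ t : ℂ, ‖t‖ ≤ r → HasDerivAt (fun t : ℂ => g (w + t • u) - g (x + t • u))
        (fderiv ℂ g (w + t • u) u - fderiv ℂ g (x + t • u) u) t :=
      fun t ht => (hline w hwr t ht).sub (hline x hxr t ht)
    have hd : DiffContOnCl ℂ (fun t : ℂ => g (w + t • u) - g (x + t • u)) (Metric.ball 0 r) := by
      refine DifferentiableOn.diffContOnCl fun t ht => ?_
      rw [closure_ball _ hr0.ne', mem_closedBall_zero_iff] at ht
      exact (hdiff t ht).differentiableAt.differentiableWithinAt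
    have hcauchy := Complex.norm_deriv_le_of_forall_mem_sphere_norm_le hr0 hd
      (C := ε / 2 * r) fun t ht => by
        have ht' : ‖t‖ ≤ r := (mem_sphere_zero_iff_norm.1 ht).le
        rw [← dist_eq_norm]
        exact (hgδ _ (hmem w hwr t ht') _ (hmem x hxr t ht')
          (by rwa [dist_add_right])).le
    rw [(hdiff 0 (by simpa using hr0.le)).deriv, mul_div_cancel_right₀ _ hr0.ne'] at hcauchy
    simpa using hcauchy

/-- A set which near `v` is the fibre of a submersion is locally path connected at `v`. -/
theorem HasStrictFDerivAt.eventually_joinedIn_of_surjective {E F : Type*}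
    [NormedAddCommGroup E] [NormedSpace ℂ E] [CompleteSpace E] [NormedAddCommGroup F]
    [NormedSpace ℂ F] [FiniteDimensional ℂ F] {g : E → F} {g' : E →L[ℂ] F} {v : E}
    (hg : HasStrictFDerivAt g g' v) (hsurj : Function.Surjective g') {Z W : Set E}
    (hW : W ∈ 𝓝 v) (hv : v ∈ Z) (hZ : Z ∩ W = {w ∈ W | g w = 0}) :
    ∀ᶠ w in 𝓝 v, w ∈ Z → JoinedIn Z v w := by
  let _ : NormedSpace ℝ E := NormedSpace.restrictScalars ℝ ℂ E
  let _ : NormedSpace ℝ F := NormedSpace.restrictScalars ℝ ℂ F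
  have hrange : g'.range = ⊤ := LinearMap.range_eq_top.2 hsurj
  set Φ := hg.implicitToOpenPartialHomeomorph g g' hrange with hΦ
  have hvs : v ∈ Φ.source := hg.mem_implicitToOpenPartialHomeomorph_source hrange
  have hfst : ∀ x, (Φ x).1 = g x := hg.implicitToOpenPartialHomeomorph_fst hrange
  have hgz : ∀ w ∈ W, w ∈ Z → g w = 0 := fun w hw hwZ => by
    have : w ∈ Z ∩ W := ⟨hwZ, hw⟩
    rw [hZ] at this
    exact this.2
  have hpre : Φ.target ∩ Φ.symm ⁻¹' W ∈ 𝓝 (Φ v) := by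
    refine Filter.inter_mem (Φ.open_target.mem_nhds (Φ.map_source hvs)) ?_
    refine (Φ.continuousAt_symm (Φ.map_source hvs)).preimage_mem_nhds ?_
    rwa [Φ.left_inv hvs]
  obtain ⟨r, hr, hball⟩ := Metric.mem_nhds_iff.1 hpre
  filter_upwards [hW, Φ.open_source.mem_nhds hvs,
    (Φ.continuousAt hvs).preimage_mem_nhds (Metric.ball_mem_nhds _ hr)] with w hwW hws hwr hwZ
  set S : Set (F × g'.ker) := Metric.ball (Φ v) r ∩ {y | y.1 = 0}
  have hconv : Convex ℝ S := by
    refine (convex_ball _ _).inter ?_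
    intro a ha b hb s t _ _ _
    simp only [mem_ofPred_eq] at ha hb ⊢
    simp [ha, hb]
  have hvS : Φ v ∈ S := ⟨Metric.mem_ball_self hr, by
    rw [mem_ofPred_eq, hfst, hgz v (mem_of_mem_nhds hW) hv]⟩
  have hwS : Φ w ∈ S := ⟨hwr, by rw [mem_ofPred_eq, hfst, hgz w hwW hwZ]⟩
  have hjoin : JoinedIn S (Φ v) (Φ w) :=
    JoinedIn.of_segment_subset (hconv.segment_subset hvS hwS)
  have himg := hjoin.map_continuousOn
    (Φ.continuousOn_symm.mono fun y hy => (hball hy.1).1)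
  rw [Φ.left_inv hvs, Φ.left_inv hws] at himg
  refine himg.mono ?_
  rintro _ ⟨y, hy, rfl⟩
  have hyt := hball hy.1
  have : Φ.symm y ∈ Z ∩ W := by
    rw [hZ]
    refine ⟨hyt.2, ?_⟩
    rw [← hfst, Φ.right_inv hyt.1]
    exact hy.2
  exact this.1

/-! ### The topology of projective space -/

section ProjectiveTopology

variable {N : ℕ}

theorem continuous_projectivization_mk' :
    Continuous (Projectivization.mk' ℂ : {v : Fin (N + 1) → ℂ // v ≠ 0} → ProjSp N) :=
  continuous_quotient_mk'

theorem isOpenMap_projectivization_mk' :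
    IsOpenMap (Projectivization.mk' ℂ : {v : Fin (N + 1) → ℂ // v ≠ 0} → ProjSp N) := by
  intro U hU
  change IsOpen ((Projectivization.mk' ℂ : {v : Fin (N + 1) → ℂ // v ≠ 0} → ProjSp N) ⁻¹' _)
  have heq : (Projectivization.mk' ℂ : {v : Fin (N + 1) → ℂ // v ≠ 0} → ProjSp N) ⁻¹'
      (Projectivization.mk' ℂ '' U) =
      ⋃ a : ℂˣ, (fun v : {v : Fin (N + 1) → ℂ // v ≠ 0} =>
        (⟨a • (v : Fin (N + 1) → ℂ), (smul_ne_zero_iff_ne a).2 v.2⟩ :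
          {v : Fin (N + 1) → ℂ // v ≠ 0})) ⁻¹' U := by
    ext v
    simp only [mem_preimage, mem_image, mem_iUnion, Projectivization.mk'_eq_mk,
      Projectivization.mk_eq_mk_iff]
    constructor
    · rintro ⟨w, hw, a, ha⟩
      refine ⟨a, ?_⟩
      convert hw
    · rintro ⟨a, ha⟩
      exact ⟨_, ha, a, rfl⟩
  rw [heq]
  refine isOpen_iUnion fun a => hU.preimage ?_
  exact (continuous_subtype_val.const_smul a).subtype_mk _

theorem Continuous.projectivization_mk {T : Type*} [TopologicalSpace T]
    {G : T → Fin (N + 1) → ℂ} (hG : Continuous G) (h0 : ∀ t, G t ≠ 0) :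
    Continuous fun t => (Projectivization.mk ℂ (G t) (h0 t) : ProjSp N) :=
  continuous_projectivization_mk'.comp (hG.subtype_mk h0)

/-- The matrix of the Hermitian orthogonal projection onto a line. -/
def lineProjection (q : ProjSp N) : Fin (N + 1) → Fin (N + 1) → ℂ :=
  Projectivization.lift
    (fun v : {v : Fin (N + 1) → ℂ // v ≠ 0} => fun i j =>
      v.1 i * (starRingEnd ℂ) (v.1 j) / ∑ k, v.1 k * (starRingEnd ℂ) (v.1 k))
    (by
      rintro ⟨v, hv⟩ ⟨w, hw⟩ t h
      have ht : t ≠ 0 := by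
        rintro rfl
        exact hv (by simpa using h)
      have ht' : (starRingEnd ℂ) t ≠ 0 := by simpa using ht
      change v = t • w at h
      subst h
      funext i j
      have hsum : ∑ k, (t • w) k * (starRingEnd ℂ) ((t • w) k) =
          (t * (starRingEnd ℂ) t) * ∑ k, w k * (starRingEnd ℂ) (w k) := by
        rw [Finset.mul_sum]
        refine Finset.sum_congr rfl fun k _ => ?_
        simp only [Pi.smul_apply, smul_eq_mul, map_mul]
        ring
      change _ / (∑ k, (t • w) k * (starRingEnd ℂ) ((t • w) k)) = _
      rw [hsum, ← mul_div_mul_left _ (∑ k, w k * (starRingEnd ℂ) (w k)) (mul_ne_zero ht ht')]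
      congr 1
      simp only [Pi.smul_apply, smul_eq_mul, map_mul]
      ring) q

theorem sum_mul_conj_ne_zero {ι : Type*} [Fintype ι] {v : ι → ℂ} (hv : v ≠ 0) :
    ∑ k, v k * (starRingEnd ℂ) (v k) ≠ 0 := by
  simp only [Complex.mul_conj]
  rw [← Complex.ofReal_sum]
  intro h
  rw [Complex.ofReal_eq_zero,
    Finset.sum_eq_zero_iff_of_nonneg fun k _ => Complex.normSq_nonneg _] at h
  exact hv (funext fun k => Complex.normSq_eq_zero.1 (h k (Finset.mem_univ k)))

theorem continuous_lineProjection : Continuous (lineProjection (N := N)) := by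
  refine continuous_coinduced_dom.2 ?_
  change Continuous fun v : {v : Fin (N + 1) → ℂ // v ≠ 0} => fun i j =>
      v.1 i * (starRingEnd ℂ) (v.1 j) / ∑ k, v.1 k * (starRingEnd ℂ) (v.1 k)
  refine continuous_pi fun i => continuous_pi fun j => ?_
  have hcoord : ∀ k, Continuous fun v : {v : Fin (N + 1) → ℂ // v ≠ 0} => v.1 k :=
    fun k => (continuous_apply k).comp continuous_subtype_val
  have hconj : ∀ k, Continuous fun v : {v : Fin (N + 1) → ℂ // v ≠ 0} =>
      (starRingEnd ℂ) (v.1 k) := fun k => Complex.continuous_conj.comp (hcoord k)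
  exact ((hcoord i).mul (hconj j)).div
    (continuous_finsetSum _ fun k _ => (hcoord k).mul (hconj k))
    fun v => sum_mul_conj_ne_zero v.2

theorem lineProjection_injective : Function.Injective (lineProjection (N := N)) := by
  intro p q
  induction p using Projectivization.ind with | h v hv =>
  induction q using Projectivization.ind with | h w hw =>
  intro h
  obtain ⟨j, hj⟩ := Function.ne_iff.1 hv
  have hj' : (starRingEnd ℂ) (v j) ≠ 0 := by simpa using hj
  have hV := sum_mul_conj_ne_zero hv
  have hWw := sum_mul_conj_ne_zero hw
  rw [Projectivization.mk_eq_mk_iff']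
  refine ⟨(starRingEnd ℂ) (w j) * (∑ k, v k * (starRingEnd ℂ) (v k)) /
    ((∑ k, w k * (starRingEnd ℂ) (w k)) * (starRingEnd ℂ) (v j)), funext fun i => ?_⟩
  have hij : v i * (starRingEnd ℂ) (v j) / ∑ k, v k * (starRingEnd ℂ) (v k) =
      w i * (starRingEnd ℂ) (w j) / ∑ k, w k * (starRingEnd ℂ) (w k) :=
    congrFun (congrFun h i) j
  rw [div_eq_div_iff hV hWw] at hij
  rw [Pi.smul_apply, smul_eq_mul, div_mul_eq_mul_div, div_eq_iff (mul_ne_zero hWw hj')]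
  linear_combination -hij

instance : T2Space (ProjSp N) :=
  .of_injective_continuous lineProjection_injective continuous_lineProjection

instance : CompactSpace (ProjSp N) := by
  have hcont : Continuous fun v : Metric.sphere (0 : Fin (N + 1) → ℂ) 1 =>
      (Projectivization.mk ℂ v.1 (ne_zero_of_mem_unit_sphere v) : ProjSp N) :=
    continuous_subtype_val.projectivization_mk _
  refine ⟨?_⟩
  convert isCompact_range hcont
  refine (Set.eq_univ_of_forall fun q => ?_).symm
  induction q using Projectivization.ind with | h v hv =>
  have hn : ‖v‖ ≠ 0 := norm_ne_zero_iff.2 hv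
  refine ⟨⟨((‖v‖ : ℂ)⁻¹) • v, ?_⟩, ?_⟩
  · rw [mem_sphere_zero_iff_norm, norm_smul]
    simp [hn]
  · rw [Projectivization.mk_eq_mk_iff']
    exact ⟨(‖v‖ : ℂ)⁻¹, rfl⟩

instance : TopologicalSpace.MetrizableSpace (ProjSp N) :=
  (continuous_lineProjection.isClosedEmbedding
    lineProjection_injective).isEmbedding.metrizableSpace

/-- A connected complex submanifold of projective space is path connected. -/
theorem IsSmoothOfDim.isPathConnected {n : ℕ} {X : Set (ProjSp N)} (hX : IsSmoothOfDim X n)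
    (hconn : IsConnected X) : IsPathConnected X := by
  have hloc : ∀ x ∈ X, ∀ᶠ y in 𝓝 x, y ∈ X → JoinedIn X x y := by
    intro x
    induction x using Projectivization.ind with | h v hv =>
    intro hx
    obtain ⟨W, g, hWo, hvW, hg, hsurj, hZ⟩ := hX v ⟨hv, hx⟩
    have hstrict := hasStrictFDerivAt_of_differentiableOn_complex hg hWo hvW
    have hev := hstrict.eventually_joinedIn_of_surjective
      (hsurj v hvW) (hWo.mem_nhds hvW) (Z := projCone X) ⟨hv, hx⟩ hZ
    have hsub : ∀ᶠ w in 𝓝 (⟨v, hv⟩ : {v : Fin (N + 1) → ℂ // v ≠ 0}),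
        w.1 ∈ projCone X → JoinedIn (projCone X) v w.1 :=
      continuous_subtype_val.continuousAt (x := ⟨v, hv⟩) |>.eventually hev
    refine Filter.mem_of_superset
      ((isOpenMap_projectivization_mk' (N := N)).image_mem_nhds hsub) ?_
    rintro _ ⟨w, hw, rfl⟩ hwX
    obtain ⟨γ, hγ⟩ := hw ⟨w.2, hwX⟩
    exact ⟨⟨⟨fun t => Projectivization.mk ℂ (γ t) (hγ t).1,
      γ.continuous.projectivization_mk _⟩, by simp, by simp⟩, fun t => (hγ t).2⟩
  obtain ⟨x₀, hx₀⟩ := hconn.nonempty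
  refine ⟨x₀, hx₀, fun {y} hy => ?_⟩
  have hP : ∀ x ∈ X, ∀ᶠ y in 𝓝[X] x, JoinedIn X x₀ x ↔ JoinedIn X x₀ y := fun x hx => by
    rw [eventually_nhdsWithin_iff]
    filter_upwards [hloc x hx] with y hxy hy
    exact ⟨fun h => h.trans (hxy hy), fun h => h.trans (hxy hy).symm⟩
  exact (hconn.isPreconnected.induction₂ (fun a b => JoinedIn X x₀ a ↔ JoinedIn X x₀ b)
    hP (fun _ _ _ _ _ _ => Iff.trans) (fun _ _ _ _ => Iff.symm) hx₀ hy).1 (.refl hx₀)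

end ProjectiveTopology

/-! ### Extending morphisms from the affine line to the projective line -/

section RationalCurves

variable {N : ℕ}

theorem Polynomial.eval_homogenize_of_snd_eq_zero {R : Type*} [CommSemiring R] (p : Polynomial R)
    (n : ℕ) {x : Fin 2 → R} (hx : x 1 = 0) :
    MvPolynomial.eval x (p.homogenize n) = p.coeff n * x 0 ^ n := by
  rw [homogenize, map_sum, Finset.sum_eq_single (n, 0)]
  · simp [MvPolynomial.eval_monomial, Finsupp.prod_fintype, Fin.prod_univ_two]
  · rintro ⟨k, l⟩ hkl hne
    have hl : l ≠ 0 := by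
      rintro rfl
      rw [Finset.HasAntidiagonal.mem_antidiagonal] at hkl
      exact hne (by simpa using hkl)
    simp [MvPolynomial.eval_monomial, Finsupp.prod_fintype, Fin.prod_univ_two, hx, hl]
  · simp

/-- The common factor of a tuple of polynomials which is not identically zero can be cancelled. -/
theorem Polynomial.exists_eq_mul_forall_exists_eval_ne_zero {K ι : Type*} [Field K] [Fintype ι]
    {G : ι → (Polynomial K)} (hG : G ≠ 0) :
    ∃ (D : (Polynomial K)) (H : ι → (Polynomial K)), D ≠ 0 ∧ (∀ j, G j = D * H j) ∧
      ∀ a, ∃ j, (H j).eval a ≠ 0 := by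
  classical
  let _ : NormalizedGCDMonoid (Polynomial K) :=
    UniqueFactorizationMonoid.toNormalizedGCDMonoid (Polynomial K)
  obtain ⟨j₀, hj₀⟩ := Function.ne_iff.1 hG
  obtain ⟨H, hH, hgcd⟩ := Finset.extract_gcd (s := Finset.univ) G ⟨j₀, Finset.mem_univ _⟩
  refine ⟨Finset.univ.gcd G, H, ?_, fun j => hH j (Finset.mem_univ j), fun a => ?_⟩
  · exact fun h => hj₀ (Finset.gcd_eq_zero_iff.1 h j₀ (Finset.mem_univ _))
  · by_contra! h
    have hdvd : X - C a ∣ Finset.univ.gcd H :=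
      Finset.dvd_gcd fun j _ => dvd_iff_isRoot.2 (h j)
    rw [hgcd] at hdvd
    exact not_isUnit_X_sub_C a (isUnit_of_dvd_one hdvd)

theorem mk_mem_projZeroLocus_iff {s : Set (MvPolynomial (Fin (N + 1)) ℂ)}
    (hs : ∀ P ∈ s, ∃ d, P.IsHomogeneous d) (v : Fin (N + 1) → ℂ) (hv : v ≠ 0) :
    Projectivization.mk ℂ v hv ∈ ProjZeroLocus s ↔ ∀ P ∈ s, MvPolynomial.eval v P = 0 := by
  obtain ⟨a, ha⟩ := Projectivization.exists_smul_eq_mk_rep ℂ v hv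
  refine forall₂_congr fun P hP => ?_
  obtain ⟨d, hd⟩ := hs P hP
  have heval : MvPolynomial.eval ((a : ℂ) • v) P = (a : ℂ) ^ d * MvPolynomial.eval v P := by
    rw [MvPolynomial.eval_eq', MvPolynomial.eval_eq', Finset.mul_sum]
    refine Finset.sum_congr rfl fun m hm => ?_
    have hdeg : ∑ i, m i = d := by
      rw [← Finsupp.degree_eq_sum, Finsupp.degree_eq_weight_one]
      exact hd (MvPolynomial.mem_support_iff.1 hm)
    simp only [Pi.smul_apply, smul_eq_mul, mul_pow, Finset.prod_mul_distrib,
      Finset.prod_pow_eq_pow_sum, hdeg]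
    ring
  rw [← ha, Units.smul_def, heval]
  simp

theorem IsProjectiveVariety.isClosed {X : Set (ProjSp N)} (hX : IsProjectiveVariety X) :
    IsClosed X := by
  obtain ⟨s, hs, rfl⟩ := hX
  refine (isClosed_coinduced (f := Projectivization.mk' ℂ)).2 ?_
  have : (Projectivization.mk' ℂ : {v : Fin (N + 1) → ℂ // v ≠ 0} → ProjSp N) ⁻¹'
      ProjZeroLocus s = ⋂ P ∈ s, {v | MvPolynomial.eval v.1 P = 0} := by
    ext v
    simp only [mem_preimage, Projectivization.mk'_eq_mk, mem_iInter]
    exact mk_mem_projZeroLocus_iff hs v.1 v.2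
  rw [this]
  exact isClosed_biInter fun P _ => isClosed_eq
    ((MvPolynomial.continuous_eval P).comp continuous_subtype_val) continuous_const

/-- A morphism from the affine line is given by polynomials without common zeros. -/
theorem MorphismToProjOf.exists_polynomial
    {F : ↥(univ : Set (Fin 1 → ℂ)) → ProjSp N} (hF : MorphismToProjOf univ F)
    (hcont : Continuous F) :
    ∃ (H : Fin (N + 1) → Polynomial ℂ)
      (hH : ∀ a : ℂ, (fun j => (H j).eval a) ≠ 0),
      ∀ a : ℂ, F ⟨fun _ => a, mem_univ _⟩ = Projectivization.mk ℂ _ (hH a) := by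
  obtain ⟨g, hg0, hg⟩ := hF ⟨fun _ => 0, mem_univ _⟩
  set G : Fin (N + 1) → Polynomial ℂ :=
    fun j => MvPolynomial.aeval (fun _ => Polynomial.X) (g j) with hGdef
  have hG : ∀ (a : ℂ) j, (G j).eval a = MvPolynomial.eval (fun _ => a) (g j) := by
    intro a j
    rw [hGdef, ← Polynomial.coe_evalRingHom, MvPolynomial.map_aeval, MvPolynomial.eval]
    congr 1
    congr 1
    · ext
      simp
    · simp
  have hGne : G ≠ 0 := by
    intro h
    refine hg0 (funext fun j => ?_)
    rw [← hG, h]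
    simp
  obtain ⟨D, H, hD, hGH, hH⟩ := Polynomial.exists_eq_mul_forall_exists_eval_ne_zero hGne
  have hH' : ∀ a : ℂ, (fun j => (H j).eval a) ≠ 0 := fun a => Function.ne_iff.2 (hH a)
  refine ⟨H, hH', ?_⟩
  have hdense : Dense {a : ℂ | D.IsRoot a}ᶜ := by
    simpa using (Polynomial.finite_setOfPred_isRoot hD).countable.dense_compl ℂ
  refine congrFun (Continuous.ext_on hdense
    (hcont.comp ((continuous_pi fun _ => continuous_id).subtype_mk _))
    (Continuous.projectivization_mk (continuous_pi fun j => (H j).continuous) hH') ?_)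
  intro a ha
  have hGa : (fun j => MvPolynomial.eval (fun _ => a) (g j)) =
      D.eval a • fun j => (H j).eval a := by
    funext j
    rw [← hG, hGH, Polynomial.eval_mul, Pi.smul_apply, smul_eq_mul]
  have hne : (fun j => MvPolynomial.eval (fun _ => a) (g j)) ≠ 0 := by
    rw [hGa]
    exact smul_ne_zero ha (hH' a)
  refine (hg ⟨fun _ => a, mem_univ _⟩ hne).trans ?_
  rw [Projectivization.mk_eq_mk_iff']
  exact ⟨D.eval a, hGa.symm⟩

/-- The closure in a projective variety of a polynomially parametrised curve is a rational
curve. -/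
theorem IsProjectiveVariety.exists_morphismFromP1 {X : Set (ProjSp N)}
    (hX : IsProjectiveVariety X) (H : Fin (N + 1) → Polynomial ℂ)
    (hH : ∀ a : ℂ, (fun j => (H j).eval a) ≠ 0)
    (hHX : ∀ a, Projectivization.mk ℂ _ (hH a) ∈ X) :
    ∃ F : ProjSp 1 → ProjSp N, MorphismFromP1 F ∧ range F ⊆ X ∧
      ∀ a, Projectivization.mk ℂ _ (hH a) ∈ range F := by
  set d := Finset.univ.sup fun j => (H j).natDegree with hd
  have hdeg : ∀ j, (H j).natDegree ≤ d := fun j =>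
    Finset.le_sup (f := fun j => (H j).natDegree) (Finset.mem_univ j)
  have hcoeff : ∃ j, (H j).coeff d ≠ 0 := by
    obtain ⟨j, -, hj⟩ := Finset.exists_mem_eq_sup Finset.univ Finset.univ_nonempty
      fun j => (H j).natDegree
    by_cases hj0 : H j = 0
    · have hd0 : d = 0 := by rw [hd, hj, hj0, Polynomial.natDegree_zero]
      obtain ⟨i, hi⟩ := Function.ne_iff.1 (hH 0)
      exact ⟨i, by rwa [hd0, Polynomial.coeff_zero_eq_eval_zero]⟩
    · refine ⟨j, ?_⟩
      rw [hd, hj]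
      exact Polynomial.leadingCoeff_ne_zero.2 hj0
  set h : (Fin 2 → ℂ) → Fin (N + 1) → ℂ :=
    fun x j => MvPolynomial.eval x ((H j).homogenize d) with hh
  have heval : ∀ x : Fin 2 → ℂ, x 1 ≠ 0 →
      h x = (x 1 ^ d) • fun j => (H j).eval (x 0 / x 1) := fun x hx => by
    funext j
    rw [hh, Pi.smul_apply, smul_eq_mul, mul_comm]
    exact Polynomial.eval_homogenize (hdeg j) x hx
  have hne : ∀ x : Fin 2 → ℂ, x ≠ 0 → h x ≠ 0 := by
    intro x hx
    by_cases hx1 : x 1 = 0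
    · have hx0 : x 0 ≠ 0 := fun hx0 => hx (funext fun i => by fin_cases i <;> assumption)
      obtain ⟨j, hj⟩ := hcoeff
      refine Function.ne_iff.2 ⟨j, ?_⟩
      change MvPolynomial.eval x ((H j).homogenize d) ≠ 0
      rw [Polynomial.eval_homogenize_of_snd_eq_zero _ _ hx1]
      exact mul_ne_zero hj (pow_ne_zero _ hx0)
    · rw [heval x hx1]
      exact smul_ne_zero (pow_ne_zero _ hx1) (hH _)
  have hmk : ∀ (x : Fin 2 → ℂ) (hx : x ≠ 0), x 1 ≠ 0 →
      Projectivization.mk ℂ (h x) (hne x hx) = Projectivization.mk ℂ _ (hH (x 0 / x 1)) := by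
    intro x hx hx1
    rw [Projectivization.mk_eq_mk_iff']
    exact ⟨_, (heval x hx1).symm⟩
  refine ⟨fun q => Projectivization.mk ℂ (h q.rep) (hne _ q.rep_nonzero),
    ⟨fun j => (H j).homogenize d, d, fun j => Polynomial.isHomogeneous_homogenize _,
      fun q => ⟨hne _ q.rep_nonzero, rfl⟩⟩, ?_, fun a => ?_⟩
  · rintro _ ⟨q, rfl⟩
    by_cases hq : q.rep 1 = 0
    · have hx0 : q.rep 0 ≠ 0 := fun hx0 =>
        q.rep_nonzero (funext fun i => by fin_cases i <;> assumption)
      set x : ℂ → Fin 2 → ℂ := fun t => ![q.rep 0, t] with hx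
      have hxne : ∀ t, x t ≠ 0 := fun t => Function.ne_iff.2 ⟨0, by simpa [hx] using hx0⟩
      have hxcont : Continuous x := by
        refine continuous_pi fun i => ?_
        fin_cases i
        · exact continuous_const
        · exact continuous_id
      have hcont : Continuous fun t =>
          (Projectivization.mk ℂ (h (x t)) (hne _ (hxne t)) : ProjSp N) :=
        Continuous.projectivization_mk
          (continuous_pi fun j => (MvPolynomial.continuous_eval _).comp hxcont) _
      have hall := closure_minimal (s := {0}ᶜ) (fun t ht => by
        rw [mem_preimage, hmk _ (hxne t) ht]
        exact hHX _) (hX.isClosed.preimage hcont)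
      have h0 := hall ((dense_compl_singleton (0 : ℂ)) 0)
      have hrep : x 0 = q.rep := funext fun i => by
        fin_cases i
        · rfl
        · exact hq.symm
      simpa [hrep] using h0
    · change Projectivization.mk ℂ (h q.rep) _ ∈ X
      rw [hmk _ q.rep_nonzero hq]
      exact hHX _
  · have hv : (![a, 1] : Fin 2 → ℂ) ≠ 0 := Function.ne_iff.2 ⟨1, by simp⟩
    refine ⟨Projectivization.mk ℂ _ hv, ?_⟩
    obtain ⟨c, hc⟩ := Projectivization.exists_smul_eq_mk_rep ℂ _ hv
    have h0 : (Projectivization.mk ℂ _ hv).rep 0 = c * a := by rw [← hc]; simp [Units.smul_def]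
    have h1 : (Projectivization.mk ℂ _ hv).rep 1 = c := by rw [← hc]; simp [Units.smul_def]
    have hratio : (Projectivization.mk ℂ _ hv).rep 0 / (Projectivization.mk ℂ _ hv).rep 1 = a := by
      rw [h0, h1, mul_div_cancel_left₀ _ c.ne_zero]
    change Projectivization.mk ℂ (h _) _ = _
    rw [hmk _ (Projectivization.rep_nonzero _) (by rw [h1]; exact c.ne_zero)]
    congr 1
    rw [hratio]

end RationalCurves

theorem isAffineAlgebraicRiemannSurface_univ :
    IsAffineAlgebraicRiemannSurface (univ : Set (Fin 1 → ℂ)) := by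
  refine ⟨⟨∅, by simp [AffZeroLocus]⟩, isConnected_univ, fun p _ => ?_⟩
  refine ⟨univ, univ, fun z _ => z, isOpen_univ, mem_univ _, isOpen_univ,
    (differentiable_pi.2 fun _ => differentiable_id).differentiableOn,
    fun a _ b _ h => congrFun h 0, fun z _ => ?_, ?_⟩
  · have hderiv : HasFDerivAt (fun z : ℂ => (fun _ : Fin 1 => z))
        (ContinuousLinearMap.pi fun _ => ContinuousLinearMap.id ℂ ℂ) z :=
      hasFDerivAt_pi.2 fun _ => hasFDerivAt_id z
    rw [hderiv.fderiv]
    intro h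
    simpa using congrFun (DFunLike.congr_fun h 1) 0
  · rw [inter_univ, image_univ]
    refine (range_eq_univ.2 fun x => ⟨x 0, funext fun i => ?_⟩).symm
    rw [Subsingleton.elim i 0]

/-- Finite subsets of the affine line are Runge. -/
theorem isRungeCompactIn_univ_of_finite {K : Set ↥(univ : Set (Fin 1 → ℂ))} (hK : K.Finite) :
    IsRungeCompactIn univ K := by
  refine ⟨hK.isCompact, fun x hx => ?_⟩
  set P : Polynomial ℂ := ∏ y ∈ hK.toFinset, (Polynomial.X - Polynomial.C (y.1 0)) with hP
  have heval : ∀ a, P.eval a = ∏ y ∈ hK.toFinset, (a - y.1 0) := fun a => by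
    simp [hP, Polynomial.eval_prod]
  refine ⟨fun y => P.eval (y.1 0), fun p _ => ⟨univ, isOpen_univ, mem_univ _, subset_univ _,
    fun v => P.eval (v 0), ?_, fun q _ => rfl⟩, ?_⟩
  · exact (P.differentiable.comp (differentiable_apply 0)).differentiableOn
  · have hzero : ∀ y ∈ K, P.eval (y.1 0) = 0 := fun y hy => by
      rw [heval]
      exact Finset.prod_eq_zero (hK.mem_toFinset.2 hy) (sub_self _)
    have hsup : (⨆ y ∈ K, ‖P.eval (y.1 0)‖) = 0 := by
      rw [← ciSup_const (ι := ↥(univ : Set (Fin 1 → ℂ))) (a := (0 : ℝ))]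
      refine iSup_congr fun y => ?_
      by_cases hy : y ∈ K
      · simp [hy, hzero y hy]
      · simp [hy]
    rw [hsup, norm_pos_iff]
    change P.eval (x.1 0) ≠ 0
    rw [heval, Finset.prod_ne_zero_iff]
    intro y hy h
    refine hx ?_
    rw [hK.mem_toFinset] at hy
    convert hy
    refine Subtype.ext (funext fun i => ?_)
    rw [Subsingleton.elim i 0]
    exact sub_eq_zero.1 h

/-- A locally constant map to projective space is holomorphic. -/
theorem holoToProjOn_of_locally_const {ι : Type*} [Fintype ι] {N : ℕ} {S : Set (ι → ℂ)}
    {f : ↥S → ProjSp N} {U : Set ↥S}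
    (hf : ∀ p ∈ U, ∃ W : Set (ι → ℂ), IsOpen W ∧ p.1 ∈ W ∧ Subtype.val ⁻¹' W ⊆ U ∧
      ∀ q : ↥S, q.1 ∈ W → f q = f p) : HoloToProjOn S f U := by
  intro p hp
  obtain ⟨W, hWo, hpW, hWU, hW⟩ := hf p hp
  refine ⟨W, hWo, hpW, hWU, fun _ => (f p).rep, differentiableOn_const _, fun q hq => ?_⟩
  exact ⟨(f p).rep_nonzero, by rw [Projectivization.mk_rep, hW q hq]⟩

/-- Every (connected) projective aOka-1 manifold is rationally
connected. -/
theorem rationally_connected_of_aOka1 {N n : ℕ} (X : Set (ProjSp N))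
    (hX : IsProjectiveManifold X n) (hconn : IsConnected X) (hOka : IsAOka1 X) :
    IsRationallyConnected X := by
  obtain ⟨hproj, hsmooth⟩ := hX
  intro p hp q hq
  obtain ⟨γ, hγ⟩ := (hsmooth.isPathConnected hconn).joinedIn p hp q hq
  set e : ℂ → ↥(univ : Set (Fin 1 → ℂ)) := fun a => ⟨fun _ => a, mem_univ _⟩
  set ρ : (Fin 1 → ℂ) → ℝ := fun v => 3 * ‖v 0‖ - 1 with hρ
  have hρc : Continuous ρ := by fun_prop
  have hf : Continuous fun v : ↥(univ : Set (Fin 1 → ℂ)) => γ.extend (ρ v.1) :=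
    γ.continuous_extend.comp (hρc.comp continuous_subtype_val)
  have hfX : ∀ t, γ.extend t ∈ X := fun t => by
    obtain ⟨s, hs⟩ : γ.extend t ∈ range γ := γ.extend_range ▸ mem_range_self t
    rw [← hs]
    exact hγ s
  set f : C(↥(univ : Set (Fin 1 → ℂ)), ↥X) :=
    ⟨fun v => ⟨γ.extend (ρ v.1), hfX _⟩, hf.subtype_mk _⟩
  have hlow : IsOpen {v : Fin 1 → ℂ | ρ v < 0} := isOpen_lt hρc continuous_const
  have hhigh : IsOpen {v : Fin 1 → ℂ | 1 < ρ v} := isOpen_lt continuous_const hρc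
  set W : Set (Fin 1 → ℂ) := {v | ρ v < 0} ∪ {v | 1 < ρ v}
  have hK : ({e 0, e 1} : Set ↥(univ : Set (Fin 1 → ℂ))).Finite := toFinite _
  have hholo : HoloToProjOn univ (fun v => (f v : ProjSp N)) (Subtype.val ⁻¹' W) := by
    refine holoToProjOn_of_locally_const fun v hv => ?_
    rcases hv with hv | hv
    · refine ⟨_, hlow, hv, fun w hw => Or.inl hw, fun w hw => ?_⟩
      exact (γ.extend_of_le_zero (le_of_lt hw)).trans (γ.extend_of_le_zero (le_of_lt hv)).symm
    · refine ⟨_, hhigh, hv, fun w hw => Or.inr hw, fun w hw => ?_⟩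
      exact (γ.extend_of_one_le (le_of_lt hw)).trans (γ.extend_of_one_le (le_of_lt hv)).symm
  have h0 : ρ (e 0).1 < 0 := by norm_num [hρ, e]
  have h1 : 1 < ρ (e 1).1 := by norm_num [hρ, e]
  obtain ⟨F, hF, -, -, hFA⟩ := hOka 1 univ isAffineAlgebraicRiemannSurface_univ {e 0, e 1}
    (isRungeCompactIn_univ_of_finite hK) {e 0, e 1} hK Subset.rfl f (Subtype.val ⁻¹' W)
    ((hlow.union hhigh).preimage continuous_subtype_val)
    (by rintro _ (rfl | rfl)
        · exact Or.inl h0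
        · exact Or.inr h1)
    hholo 1 one_pos 0 (TopologicalSpace.metrizableSpaceMetric ↥X) rfl
  have hF0 : (F (e 0) : ProjSp N) = p :=
    (hFA _ (Or.inl rfl)).1.trans (γ.extend_of_le_zero h0.le)
  have hF1 : (F (e 1) : ProjSp N) = q :=
    (hFA _ (Or.inr rfl)).1.trans (γ.extend_of_one_le h1.le)
  obtain ⟨H, hH, hFH⟩ := hF.exists_polynomial (continuous_subtype_val.comp F.continuous)
  obtain ⟨Φ, hΦ, hΦX, hΦH⟩ := hproj.exists_morphismFromP1 H hH fun a => hFH a ▸ (F (e a)).2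
  refine ⟨Φ, hΦ, hΦX, ?_, ?_⟩
  · rw [← hF0]
    exact hFH 0 ▸ hΦH 0
  · rw [← hF1]
    exact hFH 1 ▸ hΦH 1
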